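/- Let A be a Hermitian algebra and let φ : A → ℂ be a continuous spectrally multiplicative function with φ(1) = 1. Then the formula ψ(x) := φ(Re(x)) + i·φ(Im(x)) defines a character of A; moreover ψ agrees with φ on G₁(A) ∪ S_A, where G₁(A) is the connected component of the identity in the group of invertible elements of A and S_A is the set of self-adjoint elements of A. -/

import Mathlib

open scoped ComplexConjugate

/-- A character of a complex algebra: a nonzero linear multiplicative functional. -/
def IsCharacter {A : Type*} [Ring A] [Algebra ℂ A] (ψ : A → ℂ) : Prop :=
  ψ ≠ 0 ∧ IsLinearMap ℂ ψ ∧ ∀ x y : A, ψ (x * y) = ψ x * ψ y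

/-- φ is spectrally multiplicative if φ(x)·φ(y) ∈ σ(x·y) for all x, y. -/
def SpectrallyMultiplicative {A : Type*} [Ring A] [Algebra ℂ A] (φ : A → ℂ) : Prop :=
  ∀ x y : A, φ x * φ y ∈ spectrum ℂ (x * y)

/-- The Pták functional s(x) = √(ρ(x⋆x)). -/
noncomputable def ptak {A : Type*} [NormedRing A] [NormedAlgebra ℂ A] [StarRing A] (x : A) : ℝ :=
  Real.sqrt ((spectralRadius ℂ (star x * x)).toReal)

/-- The real part Re(x) = (x + x⋆)/2. -/
noncomputable def reP {A : Type*} [Ring A] [Algebra ℂ A] [StarRing A] (x : A) : A :=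
  (2 : ℂ)⁻¹ • (x + star x)

/-- The imaginary part Im(x) = (x - x⋆)/(2i). -/
noncomputable def imP {A : Type*} [Ring A] [Algebra ℂ A] [StarRing A] (x : A) : A :=
  ((2 : ℂ) * Complex.I)⁻¹ • (x - star x)

section Banach

variable {A : Type*} [NormedRing A] [NormedAlgebra ℂ A] [CompleteSpace A]

lemma exp_add_smul_eq_mul (s t : ℂ) (a : A) :
    NormedSpace.exp ((s + t) • a) = NormedSpace.exp (s • a) * NormedSpace.exp (t • a) := by
  let _ : NormedAlgebra ℚ A := NormedAlgebra.restrictScalars ℚ ℂ A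
  rw [add_smul]
  exact NormedSpace.exp_add_of_commute (((Commute.refl a).smul_left s).smul_right t)

lemma exp_nsmul_eq_pow (n : ℕ) (x : A) : NormedSpace.exp (n • x) = NormedSpace.exp x ^ n := by
  let _ : NormedAlgebra ℚ A := NormedAlgebra.restrictScalars ℚ ℂ A
  exact NormedSpace.exp_nsmul n x

lemma continuous_exp : Continuous (NormedSpace.exp : A → A) := by
  let _ : NormedAlgebra ℚ A := NormedAlgebra.restrictScalars ℚ ℂ A
  exact NormedSpace.exp_continuous

lemma exp_smul_mul_exp_neg_smul (t : ℂ) (a : A) :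
    NormedSpace.exp (t • a) * NormedSpace.exp ((-t) • a) = 1 := by
  rw [← exp_add_smul_eq_mul]; simp

lemma map_exp_algHom (χ : A →ₐ[ℂ] ℂ) (x : A) : χ (NormedSpace.exp x) = Complex.exp (χ x) := by
  let _ : NormedAlgebra ℚ A := NormedAlgebra.restrictScalars ℚ ℂ A
  rw [Complex.exp_eq_exp_ℂ]
  exact NormedSpace.map_exp χ (map_continuous χ) x

/-- The nontrivial inclusion of the spectral mapping theorem for `s ↦ p s * exp (t * s)`. -/
lemma exists_mem_spectrum_eq_eval_mul_exp (x : A) (p : Polynomial ℂ) (t : ℂ) {z : ℂ}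
    (hz : z ∈ spectrum ℂ (Polynomial.aeval x p * NormedSpace.exp (t • x))) :
    ∃ s ∈ spectrum ℂ x, z = p.eval s * Complex.exp (t * s) := by
  let _ : NormedAlgebra ℚ A := NormedAlgebra.restrictScalars ℚ ℂ A
  let B : Subalgebra ℂ A := Subalgebra.centralizer ℂ (Set.centralizer {x})
  have hcomm : ∀ u v : B, u * v = v * u := fun u v => Subtype.ext <|
    Set.centralizer_centralizer_comm_of_comm (S := {x}) (by simp) _ u.2 _ v.2
  let _ : NormedCommRing B := { (inferInstance : NormedRing B) with mul_comm := hcomm }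
  have hclosed : IsClosed (B : Set A) := Set.isClosed_centralizer _
  have : CompleteSpace B := hclosed.completeSpace_coe
  have hspec : ∀ b : B, spectrum ℂ (b : A) = spectrum ℂ b := by
    intro b
    ext w
    refine not_congr ⟨fun h => ?_, fun h => h.map B.val⟩
    obtain ⟨u, hu⟩ := h
    have hmem : (↑u⁻¹ : A) ∈ B := by
      rw [Subalgebra.mem_centralizer_iff]
      intro g hg
      have h1 : Commute g (u : A) := by
        rw [hu]
        exact (algebraMap ℂ B w - b).2 g hg
      exact h1.units_inv_right
    refine IsUnit.of_mul_eq_one ⟨_, hmem⟩ (Subtype.ext ?_)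
    change (algebraMap ℂ A w - (b : A)) * (↑u⁻¹ : A) = 1
    rw [← hu, Units.mul_inv]
  have hx : x ∈ B := Set.subset_centralizer_centralizer (Set.mem_singleton x)
  let y : B := ⟨x, hx⟩
  have hexp : ((NormedSpace.exp (t • y) : B) : A) = NormedSpace.exp (t • x) := by
    let _ : NormedAlgebra ℚ B := NormedAlgebra.restrictScalars ℚ ℂ B
    exact NormedSpace.map_exp B.val continuous_subtype_val (t • y)
  have haev : ((Polynomial.aeval y p : B) : A) = Polynomial.aeval x p :=
    (Polynomial.aeval_algHom_apply B.val y p).symm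
  rw [← hexp, ← haev, ← Subalgebra.coe_mul, hspec,
    WeakDual.CharacterSpace.mem_spectrum_iff_exists] at hz
  obtain ⟨f, hf⟩ := hz
  let χ : B →ₐ[ℂ] ℂ := WeakDual.CharacterSpace.toAlgHom f
  refine ⟨χ y, ?_, ?_⟩
  · change χ y ∈ spectrum ℂ (y : A)
    rw [hspec]
    exact AlgHom.apply_mem_spectrum χ y
  · have h1 : χ (NormedSpace.exp (t • y)) = Complex.exp (χ (t • y)) := map_exp_algHom χ _
    have h2 : χ (Polynomial.aeval y p * NormedSpace.exp (t • y)) = z := hf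
    rw [map_mul, h1, ← Polynomial.aeval_algHom_apply, map_smul, smul_eq_mul] at h2
    rw [← h2, Polynomial.coe_aeval_eq_eval]

lemma exists_mem_spectrum_eq_exp (x : A) (t : ℂ) {z : ℂ}
    (hz : z ∈ spectrum ℂ (NormedSpace.exp (t • x))) :
    ∃ s ∈ spectrum ℂ x, z = Complex.exp (t * s) := by
  obtain ⟨s, hs, h⟩ := exists_mem_spectrum_eq_eval_mul_exp x 1 t (z := z) (by simpa using hz)
  exact ⟨s, hs, by simpa using h⟩

lemma range_exp_mem_nhds : Set.range (NormedSpace.exp : A → A) ∈ nhds (1 : A) := by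
  have h : HasStrictFDerivAt (NormedSpace.exp : A → A)
      ((ContinuousLinearEquiv.refl ℂ A : A ≃L[ℂ] A) : A →L[ℂ] A) 0 :=
    hasStrictFDerivAt_exp_zero (𝕂 := ℂ) (𝔸 := A)
  have h2 := h.map_nhds_eq_of_equiv
  rw [NormedSpace.exp_zero] at h2
  rw [← h2]
  exact Filter.range_mem_map

/-- The Lie product formula. -/
lemma tendsto_exp_mul_exp_pow (x y : A) :
    Filter.Tendsto (fun n : ℕ => (NormedSpace.exp (((n : ℂ)⁻¹) • x) *
      NormedSpace.exp (((n : ℂ)⁻¹) • y)) ^ n) Filter.atTop (nhds (NormedSpace.exp (x + y))) := by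
  have h : HasStrictFDerivAt (NormedSpace.exp : A → A)
      ((ContinuousLinearEquiv.refl ℂ A : A ≃L[ℂ] A) : A →L[ℂ] A) 0 :=
    hasStrictFDerivAt_exp_zero (𝕂 := ℂ) (𝔸 := A)
  let u : ℂ → A := fun t => NormedSpace.exp (t • x) * NormedSpace.exp (t • y)
  have hu0 : u 0 = 1 := by simp [u]
  have hd : ∀ w : A, HasDerivAt (fun t : ℂ => NormedSpace.exp (t • w)) w 0 := fun w => by
    simpa using hasDerivAt_exp_smul_const (𝕂 := ℂ) w (0 : ℂ)
  have hu : HasDerivAt u (x + y) 0 := by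
    have := (hd x).mul (hd y)
    simp only [zero_smul, NormedSpace.exp_zero, mul_one, one_mul] at this
    exact this
  let L := h.localInverse
  have hL0 : L 1 = 0 := by simpa using h.localInverse_apply_image
  have hL : HasFDerivAt L (ContinuousLinearMap.id ℂ A) (u 0) := by
    have := h.to_localInverse.hasFDerivAt
    rw [NormedSpace.exp_zero] at this
    rw [hu0]
    simpa using this
  have hcomp : HasDerivAt (fun t => L (u t)) (x + y) 0 :=
    hL.comp_hasDerivAt (0 : ℂ) hu
  have hinv : Filter.Tendsto (fun n : ℕ => ((n : ℂ)⁻¹)) Filter.atTop (nhds 0) :=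
    tendsto_inv_atTop_nhds_zero_nat (𝕜 := ℂ)
  have hslope : Filter.Tendsto (fun n : ℕ => n • L (u ((n : ℂ)⁻¹))) Filter.atTop
      (nhds (x + y)) := by
    have h1 := hcomp.tendsto_slope_zero
    simp only [zero_add, hu0, hL0, sub_zero] at h1
    have h2 : Filter.Tendsto (fun n : ℕ => ((n : ℂ)⁻¹)) Filter.atTop (nhdsWithin 0 {0}ᶜ) := by
      refine tendsto_nhdsWithin_iff.2 ⟨hinv, ?_⟩
      filter_upwards [Filter.eventually_gt_atTop 0] with n hn
      simp [hn.ne']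
    refine (h1.comp h2).congr fun n => ?_
    simp [Nat.cast_smul_eq_nsmul]
  have hev : ∀ᶠ n : ℕ in Filter.atTop, NormedSpace.exp (L (u ((n : ℂ)⁻¹))) = u ((n : ℂ)⁻¹) := by
    have h1 := h.eventually_right_inverse
    rw [NormedSpace.exp_zero, ← hu0] at h1
    exact (hu.continuousAt.tendsto.comp hinv).eventually h1
  refine ((continuous_exp.tendsto _).comp hslope).congr' ?_
  filter_upwards [hev] with n hn
  rw [Function.comp_apply, exp_nsmul_eq_pow, hn]

/-- A closed submonoid containing all exponentials contains the principal component. -/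
lemma connectedComponentIn_isUnit_subset {Q : Submonoid A} (hQ : IsClosed (Q : Set A))
    (hexp : ∀ x : A, NormedSpace.exp x ∈ Q) :
    connectedComponentIn {x : A | IsUnit x} 1 ⊆ Q := by
  have hsub := connectedComponentIn_subset {x : A | IsUnit x} 1
  have key : connectedComponentIn {x : A | IsUnit x} 1 ⊆ (Q : Set A) ∩ {x | IsUnit x} := by
    refine isPreconnected_connectedComponentIn.subset_of_closure_inter_subset ?_ ?_ ?_
    · rw [isOpen_iff_mem_nhds]
      rintro g ⟨hg, u, rfl⟩
      refine Filter.inter_mem ?_ (Units.isOpen.mem_nhds u.isUnit)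
      have hc : Filter.Tendsto (fun x : A => (↑u⁻¹ : A) * x) (nhds (u : A)) (nhds 1) := by
        have := (continuous_const_mul (↑u⁻¹ : A)).tendsto (u : A)
        rwa [Units.inv_mul] at this
      filter_upwards [hc range_exp_mem_nhds] with x hx
      obtain ⟨y, hy⟩ := hx
      have : x = u * NormedSpace.exp y := by rw [hy, Units.mul_inv_cancel_left]
      rw [this]
      exact Q.mul_mem hg (hexp y)
    · exact ⟨1, mem_connectedComponentIn isUnit_one, Q.one_mem, isUnit_one⟩
    · rintro x ⟨hx, hxs⟩
      exact ⟨hQ.closure_subset (closure_mono Set.inter_subset_left hx), hsub hxs⟩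
  exact fun x hx => (key hx).1

end Banach

/-- A function whose logarithmic difference quotients are all real is an exponential. -/
lemma exists_eq_mul_exp_of_forall_real_quotient {F : ℂ → ℂ} {S : Set ℂ} (hS : ∀ z ∈ S, z.im = 0)
    (h0 : F 0 ≠ 0) (hF : ∀ s t : ℂ, ∃ k ∈ S, F s = F t * Complex.exp ((s - t) * k)) :
    ∃ c ∈ S, ∀ s, F s = F 0 * Complex.exp (s * c) := by
  have hF' : ∀ s t : ℂ, ∃ k : ℝ, (k : ℂ) ∈ S ∧ F s = F t * Complex.exp ((s - t) * k) := by
    intro s t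
    obtain ⟨k, hk, h⟩ := hF s t
    have hk' : ((k.re : ℝ) : ℂ) = k := Complex.ext (by simp) (by simp [hS k hk])
    exact ⟨k.re, by rwa [hk'], by rwa [hk']⟩
  have hre : ∀ z w : ℂ, Complex.exp z = Complex.exp w → z.re = w.re := fun z w h => by
    have := congrArg norm h
    rwa [Complex.norm_exp, Complex.norm_exp, Real.exp_eq_exp] at this
  have hcross : ∀ x : ℝ, x ≠ 0 → ∃ k : ℝ, (k : ℂ) ∈ S ∧ F x = F 0 * Complex.exp (x * k) ∧
      ∀ y : ℝ, F (y * Complex.I) = F 0 * Complex.exp (y * Complex.I * k) := by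
    intro x hx
    obtain ⟨k, hkS, hk⟩ := hF' x 0
    rw [sub_zero] at hk
    refine ⟨k, hkS, hk, fun y => ?_⟩
    obtain ⟨m, -, hm⟩ := hF' (y * Complex.I) 0
    obtain ⟨l, -, hl⟩ := hF' x (y * Complex.I)
    rw [sub_zero] at hm
    have h1 : Complex.exp (x * k) =
        Complex.exp (y * Complex.I * m + (x - y * Complex.I) * l) := by
      apply mul_left_cancel₀ h0
      rw [Complex.exp_add, ← hk, ← mul_assoc, ← hm, hl]
    have h2 := hre _ _ h1
    simp at h2
    have h3 : k = l := by
      rcases h2 with h | h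
      · exact h
      · exact absurd h hx
    subst h3
    have h4 : Complex.exp (y * Complex.I * m + (x - y * Complex.I) * k) *
        Complex.exp (y * Complex.I * k - x * k) = Complex.exp (y * Complex.I * m) := by
      rw [← Complex.exp_add]; ring_nf
    rw [hm, ← h4, ← h1, ← Complex.exp_add]
    ring_nf
  obtain ⟨c, hcS, hc1, hcI⟩ := hcross 1 one_ne_zero
  have hR : ∀ x : ℝ, F x = F 0 * Complex.exp (x * c) := by
    intro x
    rcases eq_or_ne x 0 with rfl | hx
    · simp
    obtain ⟨k, -, hk, hkI⟩ := hcross x hx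
    suffices k = c by rw [← this, hk]
    by_contra hne
    have hd : k - c ≠ 0 := sub_ne_zero.2 hne
    have h1 := (hkI (Real.pi / (k - c))).symm.trans (hcI (Real.pi / (k - c)))
    have h2 := mul_left_cancel₀ h0 h1
    have hd' : (k : ℂ) - c ≠ 0 := by exact_mod_cast hd
    have h3 : Complex.exp (Real.pi * Complex.I) = 1 := by
      have : (Real.pi * Complex.I : ℂ) = ((Real.pi / (k - c) : ℝ) : ℂ) * Complex.I * k -
          ((Real.pi / (k - c) : ℝ) : ℂ) * Complex.I * c := by
        push_cast
        field_simp
      rw [this, Complex.exp_sub, h2, div_self (Complex.exp_ne_zero _)]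
    rw [Complex.exp_pi_mul_I] at h3
    norm_num at h3
  refine ⟨c, hcS, fun s => ?_⟩
  obtain ⟨k, -, hk⟩ := hF' s s.re
  obtain ⟨l, -, hl⟩ := hF' s (s.im * Complex.I)
  have e1 : s - s.re = s.im * Complex.I := by
    nth_rewrite 1 [← Complex.re_add_im s]; ring
  have e2 : s - s.im * Complex.I = s.re := by
    nth_rewrite 1 [← Complex.re_add_im s]; ring
  rw [e1, hR, mul_assoc, ← Complex.exp_add] at hk
  rw [e2, hcI, mul_assoc, ← Complex.exp_add] at hl
  have h2 := hre _ _ (mul_left_cancel₀ h0 (hk.symm.trans hl))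
  simp at h2
  have h3 : (s.re : ℂ) * c = s.re * l := by
    rcases h2 with h | h <;> simp [h]
  rw [hl, ← h3]
  nth_rewrite 3 [← Complex.re_add_im s]
  ring_nf

/-- A linear functional preserving squares is multiplicative. -/
lemma LinearMap.map_mul_of_map_mul_self {R : Type*} [Ring R] [Algebra ℂ R] (f : R →ₗ[ℂ] ℂ)
    (h1 : f 1 = 1) (hsq : ∀ x, f (x * x) = f x * f x) (x y : R) : f (x * y) = f x * f y := by
  have hjordan : ∀ x y, f (x * y) + f (y * x) = 2 * (f x * f y) := fun x y => by
    have h := hsq (x + y)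
    simp only [add_mul, mul_add, map_add, hsq] at h
    linear_combination h
  have hker : ∀ x y, f x = 0 → f (x * y) = 0 := by
    intro x y hx
    have hadd : f (x * y) + f (y * x) = 0 := by rw [hjordan, hx]; ring
    have hid : (x * y - y * x) * (x * y - y * x) + (x * y + y * x) * (x * y + y * x) =
        (x * (y * x * y) + (y * x * y) * x) + (x * (y * x * y) + (y * x * y) * x) := by
      noncomm_ring
    have h := congrArg f hid
    simp only [map_add, hsq, map_sub] at h
    have hsub : f (x * y) - f (y * x) = 0 := mul_self_eq_zero.1 (by
      linear_combination h + 2 * hjordan x (y * x * y) - (f (x * y) + f (y * x)) * hadd +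
        4 * f (y * x * y) * hx)
    linear_combination (hadd + hsub) / 2
  have h := hker (x - f x • 1) y (by simp [h1])
  rw [sub_mul, smul_mul_assoc, one_mul, map_sub, map_smul, smul_eq_mul] at h
  linear_combination h

section ExpSubmonoid

variable {A : Type*} [NormedRing A] [NormedAlgebra ℂ A] [CompleteSpace A]

/-- The submonoid generated by the exponentials of the complex multiples of elements of `S`. -/
def expSubmonoid (S : Set A) : Submonoid A :=
  Submonoid.closure {x : A | ∃ a ∈ S, ∃ t : ℂ, x = NormedSpace.exp (t • a)}

lemma exp_mem_topologicalClosure {S : Set A}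
    (hspan : ∀ x : A, ∃ a ∈ S, ∃ b ∈ S, x = a + Complex.I • b) (x : A) :
    NormedSpace.exp x ∈ (expSubmonoid S).topologicalClosure := by
  obtain ⟨a, ha, b, hb, rfl⟩ := hspan x
  refine mem_closure_of_tendsto (tendsto_exp_mul_exp_pow a (Complex.I • b))
    (Filter.Eventually.of_forall fun n => ?_)
  refine pow_mem (mul_mem ?_ ?_) n
  · exact Submonoid.subset_closure ⟨a, ha, _, rfl⟩
  · exact Submonoid.subset_closure ⟨b, hb, _, congrArg _ (smul_smul _ _ _)⟩

end ExpSubmonoid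

namespace SpectrallyMultiplicative

variable {A : Type*} [NormedRing A] [NormedAlgebra ℂ A] {φ : A → ℂ}

lemma apply_mul_apply_eq_one (hsm : SpectrallyMultiplicative φ) {x y : A} (hxy : x * y = 1) :
    φ x * φ y = 1 := by
  have hne : Nontrivial A := by
    by_contra h
    have := not_nontrivial_iff_subsingleton.1 h
    simpa [spectrum.of_subsingleton] using hsm 1 1
  have := hsm x y
  rw [hxy, spectrum.one_eq] at this
  exact this

lemma apply_mem_spectrum (hsm : SpectrallyMultiplicative φ) (h1 : φ 1 = 1) (x : A) :
    φ x ∈ spectrum ℂ x := by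
  simpa [h1] using hsm x 1

lemma apply_unit_ne_zero (hsm : SpectrallyMultiplicative φ) (h1 : φ 1 = 1) (u : Aˣ) :
    φ u ≠ 0 := fun h => by
  have := hsm.apply_mem_spectrum h1 (u : A)
  rw [h] at this
  exact spectrum.zero_notMem ℂ u.isUnit this

variable [CompleteSpace A]

lemma exists_apply_mul_exp (hsm : SpectrallyMultiplicative φ) (h1 : φ 1 = 1)
    {a : A} (ha : ∀ z ∈ spectrum ℂ a, z.im = 0) (u : Aˣ) :
    ∃ c ∈ spectrum ℂ a, ∀ t : ℂ,
      φ (u * NormedSpace.exp (t • a)) = φ u * Complex.exp (t * c) := by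
  have h := exists_eq_mul_exp_of_forall_real_quotient
    (F := fun t => φ (u * NormedSpace.exp (t • a))) (S := spectrum ℂ a) ha
    (by simpa using hsm.apply_unit_ne_zero h1 u) fun s t => ?_
  · simpa using h
  have hinv : φ (u * NormedSpace.exp (t • a)) * φ (NormedSpace.exp ((-t) • a) * ↑u⁻¹) = 1 := by
    apply hsm.apply_mul_apply_eq_one
    rw [mul_assoc, ← mul_assoc (NormedSpace.exp (t • a)), exp_smul_mul_exp_neg_smul, one_mul,
      Units.mul_inv]
  have hmem := hsm (NormedSpace.exp ((-t) • a) * ↑u⁻¹) (u * NormedSpace.exp (s • a))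
  rw [mul_assoc, Units.inv_mul_cancel_left, ← exp_add_smul_eq_mul, neg_add_eq_sub] at hmem
  obtain ⟨k, hk, h⟩ := exists_mem_spectrum_eq_exp a _ hmem
  refine ⟨k, hk, ?_⟩
  rw [← h]
  linear_combination -φ (u * NormedSpace.exp (s • a)) * hinv

lemma exists_apply_exp_mul (hsm : SpectrallyMultiplicative φ) (h1 : φ 1 = 1)
    {a : A} (ha : ∀ z ∈ spectrum ℂ a, z.im = 0) (u : Aˣ) :
    ∃ c ∈ spectrum ℂ a, ∀ t : ℂ,
      φ (NormedSpace.exp (t • a) * u) = φ u * Complex.exp (t * c) := by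
  have h := exists_eq_mul_exp_of_forall_real_quotient
    (F := fun t => φ (NormedSpace.exp (t • a) * u)) (S := spectrum ℂ a) ha
    (by simpa using hsm.apply_unit_ne_zero h1 u) fun s t => ?_
  · simpa using h
  have hinv : φ (NormedSpace.exp (t • a) * u) * φ (↑u⁻¹ * NormedSpace.exp ((-t) • a)) = 1 := by
    apply hsm.apply_mul_apply_eq_one
    rw [mul_assoc, Units.mul_inv_cancel_left, exp_smul_mul_exp_neg_smul]
  have hmem := hsm (NormedSpace.exp (s • a) * u) (↑u⁻¹ * NormedSpace.exp ((-t) • a))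
  rw [mul_assoc, Units.mul_inv_cancel_left, ← exp_add_smul_eq_mul, ← sub_eq_add_neg] at hmem
  obtain ⟨k, hk, h⟩ := exists_mem_spectrum_eq_exp a _ hmem
  refine ⟨k, hk, ?_⟩
  rw [← h]
  linear_combination -φ (NormedSpace.exp (s • a) * u) * hinv

lemma exists_apply_aeval (hsm : SpectrallyMultiplicative φ) (h1 : φ 1 = 1)
    (hcont : Continuous φ) {a : A} (ha : ∀ z ∈ spectrum ℂ a, z.im = 0) :
    ∃ c : ℂ, (∀ t : ℂ, φ (NormedSpace.exp (t • a)) = Complex.exp (t * c)) ∧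
      ∀ p : Polynomial ℂ, (∀ s ∈ spectrum ℂ a, (p.eval s).im = 0) →
        φ (Polynomial.aeval a p) = p.eval c := by
  obtain ⟨c, hc, hexp⟩ := hsm.exists_apply_mul_exp h1 ha 1
  simp only [Units.val_one, one_mul, h1] at hexp
  refine ⟨c, hexp, fun p hp => ?_⟩
  have key : ∀ y : ℝ, y ≠ 0 →
      φ (Polynomial.aeval a p + algebraMap ℂ A (y * Complex.I)) = p.eval c + y * Complex.I := by
    intro y hy
    let q : Polynomial ℂ := p + Polynomial.C (y * Complex.I)
    have hq : ∀ s, q.eval s = p.eval s + y * Complex.I := fun s => by simp [q]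
    have haev : Polynomial.aeval a q =
        Polynomial.aeval a p + algebraMap ℂ A (y * Complex.I) := by simp [q]
    have hqim : ∀ s ∈ spectrum ℂ a, (q.eval s).im = y := fun s hs => by simp [hq, hp s hs]
    rw [← haev, ← hq]
    have him : (φ (Polynomial.aeval a q)).im = y := by
      obtain ⟨s, hs, h⟩ := exists_mem_spectrum_eq_eval_mul_exp a q 0
        (z := φ (Polynomial.aeval a q)) (by simpa using hsm.apply_mem_spectrum h1 _)
      rw [h]
      simp [hqim s hs]
    obtain ⟨s, hs, h⟩ := exists_mem_spectrum_eq_eval_mul_exp a q (-1)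
      (hsm (Polynomial.aeval a q) (NormedSpace.exp ((-1 : ℂ) • a)))
    rw [hexp] at h
    have h' : φ (Polynomial.aeval a q) = q.eval s * Complex.exp (c - s) := by
      calc φ (Polynomial.aeval a q)
          = φ (Polynomial.aeval a q) * Complex.exp (-1 * c) * Complex.exp c := by
            rw [mul_assoc, ← Complex.exp_add]; simp
        _ = q.eval s * Complex.exp (c - s) := by
            rw [h, mul_assoc, ← Complex.exp_add]; ring_nf
    have hcs : ((c.re - s.re : ℝ) : ℂ) = c - s :=
      Complex.ext (by simp) (by simp [ha c hc, ha s hs])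
    have h2 := congrArg Complex.im h'
    rw [him, ← hcs, ← Complex.ofReal_exp, Complex.im_mul_ofReal, hqim s hs] at h2
    have h3 : Real.exp (c.re - s.re) = 1 := (mul_eq_left₀ hy).1 h2.symm
    rw [Real.exp_eq_one_iff] at h3
    have h4 : c = s := by rw [← sub_eq_zero, ← hcs, h3, Complex.ofReal_zero]
    rw [h', h4]
    simp
  have heq := Continuous.ext_on (dense_compl_singleton (0 : ℝ))
    (f := fun y : ℝ => φ (Polynomial.aeval a p + algebraMap ℂ A (y * Complex.I)))
    (g := fun y : ℝ => p.eval c + y * Complex.I)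
    (hcont.comp (continuous_const.add ((algebraMapCLM ℂ A).continuous.comp (by fun_prop))))
    (by fun_prop) (fun y hy => key y hy)
  simpa using congrFun heq 0

lemma apply_aeval (hsm : SpectrallyMultiplicative φ) (h1 : φ 1 = 1)
    (hcont : Continuous φ) {a : A} (ha : ∀ z ∈ spectrum ℂ a, z.im = 0) (p : Polynomial ℂ)
    (hp : ∀ s ∈ spectrum ℂ a, (p.eval s).im = 0) :
    φ (Polynomial.aeval a p) = p.eval (φ a) := by
  obtain ⟨c, -, h⟩ := hsm.exists_apply_aeval h1 hcont ha
  have hX := h Polynomial.X (by simpa using ha)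
  simp only [Polynomial.aeval_X, Polynomial.eval_X] at hX
  rw [hX]
  exact h p hp

lemma apply_exp_smul (hsm : SpectrallyMultiplicative φ) (h1 : φ 1 = 1)
    (hcont : Continuous φ) {a : A} (ha : ∀ z ∈ spectrum ℂ a, z.im = 0) (t : ℂ) :
    φ (NormedSpace.exp (t • a)) = Complex.exp (t * φ a) := by
  obtain ⟨c, hexp, h⟩ := hsm.exists_apply_aeval h1 hcont ha
  have hX := h Polynomial.X (by simpa using ha)
  simp only [Polynomial.aeval_X, Polynomial.eval_X] at hX
  rw [hX]
  exact hexp t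

/-- Bounded exponential growth forces equality of exponents. -/
lemma apply_exp_mul_mul_exp (hsm : SpectrallyMultiplicative φ) (h1 : φ 1 = 1)
    {a b : A} (ha : ∀ z ∈ spectrum ℂ a, z.im = 0) (hb : ∀ z ∈ spectrum ℂ b, z.im = 0)
    (u : Aˣ) (hu : ∀ t : ℂ, φ (NormedSpace.exp (t • a) * u) = φ u * Complex.exp (t * φ a)) (r t : ℂ) :
    φ (NormedSpace.exp (t • a) * (u * NormedSpace.exp (r • b))) =
      φ (u * NormedSpace.exp (r • b)) * Complex.exp (t * φ a) := by
  let e : A → ℂ → Aˣ := fun x t =>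
    ⟨NormedSpace.exp (t • x), NormedSpace.exp ((-t) • x), exp_smul_mul_exp_neg_smul t x, by
      simpa using exp_smul_mul_exp_neg_smul (-t) x⟩
  obtain ⟨d, hd, hleft⟩ := hsm.exists_apply_exp_mul h1 ha (u * e b r)
  have hleft' : ∀ t : ℂ, φ (NormedSpace.exp (t • a) * (u * NormedSpace.exp (r • b))) =
      φ (u * NormedSpace.exp (r • b)) * Complex.exp (t * d) := hleft
  suffices h : d = φ a by rw [hleft', h]
  have hright : ∀ t : ℂ, ∃ k ∈ spectrum ℂ b,
      φ (NormedSpace.exp (t • a) * (u * NormedSpace.exp (r • b))) =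
        φ u * Complex.exp (t * φ a) * Complex.exp (r * k) := by
    intro t
    obtain ⟨k, hk, h⟩ := hsm.exists_apply_mul_exp h1 hb (e a t * u)
    refine ⟨k, hk, ?_⟩
    rw [← hu, ← mul_assoc]
    exact h r
  have hφa := ha _ (hsm.apply_mem_spectrum h1 a)
  by_contra hne
  have hδ : d.re - (φ a).re ≠ 0 := fun h =>
    hne (Complex.ext (sub_eq_zero.1 h) (by rw [ha d hd, hφa]))
  set δ := d.re - (φ a).re with hδ_def
  set M : ℝ := ‖b‖ * ‖(1 : A)‖
  have hM : ∀ k ∈ spectrum ℂ b, ‖k‖ ≤ M := fun k hk => spectrum.norm_le_norm_mul_of_mem hk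
  let τ : ℝ := (‖r‖ * (M + M) + 1) / δ
  obtain ⟨k, hk, hkeq⟩ := hright τ
  obtain ⟨k', hk', hkeq'⟩ := hright 0
  have h0 := hleft' 0
  rw [hkeq'] at h0
  rw [hleft' τ] at hkeq
  simp only [zero_mul, Complex.exp_zero, mul_one] at h0
  rw [← h0] at hkeq
  have hexp : Complex.exp (r * k' + τ * d) = Complex.exp (τ * φ a + r * k) := by
    apply mul_left_cancel₀ (hsm.apply_unit_ne_zero h1 u)
    rw [Complex.exp_add, Complex.exp_add]
    linear_combination hkeq
  have hn := congrArg norm hexp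
  rw [Complex.norm_exp, Complex.norm_exp, Real.exp_eq_exp] at hn
  simp only [Complex.add_re, Complex.re_ofReal_mul] at hn
  have hτ : τ * δ = ‖r‖ * (M + M) + 1 := div_mul_cancel₀ _ hδ
  have hbound : (r * k).re - (r * k').re ≤ ‖r‖ * (M + M) := by
    rw [← Complex.sub_re, ← mul_sub]
    refine (Complex.re_le_norm _).trans ?_
    rw [norm_mul]
    gcongr
    exact (norm_sub_le _ _).trans (add_le_add (hM k hk) (hM k' hk'))
  rw [hδ_def] at hτ
  linarith

lemma apply_mul_of_mem_expSubmonoid (hsm : SpectrallyMultiplicative φ) (h1 : φ 1 = 1)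
    (hcont : Continuous φ) {S : Set A}
    (hS : ∀ a ∈ S, ∀ z ∈ spectrum ℂ a, z.im = 0)
    {g h : A} (hg : g ∈ expSubmonoid S) (hh : h ∈ expSubmonoid S) : φ (g * h) = φ g * φ h := by
  have hK : ∀ h ∈ expSubmonoid S,
      IsUnit h ∧ ∀ a ∈ S, ∀ t : ℂ,
        φ (NormedSpace.exp (t • a) * h) = φ h * Complex.exp (t * φ a) := by
    intro h hh
    induction hh using Submonoid.closure_induction_right with
    | one =>
      refine ⟨isUnit_one, fun a ha t => ?_⟩
      rw [mul_one, h1, one_mul, hsm.apply_exp_smul h1 hcont (hS a ha)]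
    | mul_right x hx y hy ih =>
      obtain ⟨b, hb, r, rfl⟩ := hy
      obtain ⟨⟨u, rfl⟩, ih⟩ := ih
      have hunit : IsUnit (NormedSpace.exp (r • b)) :=
        ⟨⟨_, NormedSpace.exp ((-r) • b), exp_smul_mul_exp_neg_smul r b, by
          simpa using exp_smul_mul_exp_neg_smul (-r) b⟩, rfl⟩
      exact ⟨u.isUnit.mul hunit, fun a ha t =>
        hsm.apply_exp_mul_mul_exp h1 (hS a ha) (hS b hb) u (ih a ha) r t⟩
  induction hg using Submonoid.closure_induction_left with
  | one => rw [one_mul, h1, one_mul]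
  | mul_left x hx y hy ih =>
    obtain ⟨a, ha, t, rfl⟩ := hx
    rw [mul_assoc, (hK _ (mul_mem hy hh)).2 a ha, (hK y hy).2 a ha, ih]
    ring

lemma apply_mul_of_mem_topologicalClosure (hsm : SpectrallyMultiplicative φ) (h1 : φ 1 = 1)
    (hcont : Continuous φ) {S : Set A}
    (hS : ∀ a ∈ S, ∀ z ∈ spectrum ℂ a, z.im = 0)
    {g h : A} (hg : g ∈ (expSubmonoid S).topologicalClosure)
    (hh : h ∈ (expSubmonoid S).topologicalClosure) :
    φ (g * h) = φ g * φ h := by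
  have hcl : IsClosed {p : A × A | φ (p.1 * p.2) = φ p.1 * φ p.2} :=
    isClosed_eq (by fun_prop) (by fun_prop)
  have hgh : (g, h) ∈ closure ((expSubmonoid S : Set A) ×ˢ (expSubmonoid S : Set A)) := by
    rw [closure_prod_eq]
    exact ⟨hg, hh⟩
  refine hcl.closure_subset_iff.2 (fun p hp => ?_) hgh
  exact hsm.apply_mul_of_mem_expSubmonoid h1 hcont hS hp.1 hp.2

lemma apply_exp_add (hsm : SpectrallyMultiplicative φ) (h1 : φ 1 = 1)
    (hcont : Continuous φ) {S : Set A}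
    (hS : ∀ a ∈ S, ∀ z ∈ spectrum ℂ a, z.im = 0)
    (hspan : ∀ x : A, ∃ a ∈ S, ∃ b ∈ S, x = a + Complex.I • b) (x y : A) :
    φ (NormedSpace.exp (x + y)) = φ (NormedSpace.exp x) * φ (NormedSpace.exp y) := by
  have hmem := exp_mem_topologicalClosure hspan
  have hmul := fun {g h : A} =>
    hsm.apply_mul_of_mem_topologicalClosure h1 hcont hS (g := g) (h := h)
  have hpow : ∀ (n : ℕ) (g : A), g ∈ (expSubmonoid S).topologicalClosure →
      φ (g ^ n) = φ g ^ n := by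
    intro n g hg
    induction n with
    | zero => simpa using h1
    | succ n ih => rw [pow_succ, hmul (pow_mem hg n) hg, ih, pow_succ]
  refine tendsto_nhds_unique ((hcont.tendsto _).comp (tendsto_exp_mul_exp_pow x y))
    (tendsto_const_nhds.congr' ?_)
  filter_upwards [Filter.eventually_gt_atTop 0] with n hn
  have hroot : ∀ z : A, NormedSpace.exp ((n : ℂ)⁻¹ • z) ^ n = NormedSpace.exp z := fun z => by
    rw [← exp_nsmul_eq_pow, ← Nat.cast_smul_eq_nsmul ℂ, smul_smul,
      mul_inv_cancel₀ (by exact_mod_cast hn.ne'), one_smul]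
  rw [Function.comp_apply, hpow n _ (mul_mem (hmem _) (hmem _)), hmul (hmem _) (hmem _), mul_pow,
    ← hpow n _ (hmem _), ← hpow n _ (hmem _), hroot, hroot]

lemma apply_add (hsm : SpectrallyMultiplicative φ) (h1 : φ 1 = 1)
    (hcont : Continuous φ) {S : Set A}
    (hS : ∀ a ∈ S, ∀ z ∈ spectrum ℂ a, z.im = 0)
    (hspan : ∀ x : A, ∃ a ∈ S, ∃ b ∈ S, x = a + Complex.I • b) {a b : A}
    (ha : a ∈ S) (hb : b ∈ S) (hab : a + b ∈ S) : φ (a + b) = φ a + φ b := by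
  have h := hsm.apply_exp_add h1 hcont hS hspan a b
  have hexp : ∀ c ∈ S, φ (NormedSpace.exp c) = Complex.exp (φ c) := fun c hc => by
    simpa using hsm.apply_exp_smul h1 hcont (hS c hc) 1
  have him : ∀ c ∈ S, (φ c).im = 0 := fun c hc => hS c hc _ (hsm.apply_mem_spectrum h1 c)
  rw [hexp _ ha, hexp _ hb, hexp _ hab, ← Complex.exp_add] at h
  have hn := congrArg norm h
  rw [Complex.norm_exp, Complex.norm_exp, Real.exp_eq_exp] at hn
  exact Complex.ext hn (by rw [Complex.add_im, him _ ha, him _ hb, him _ hab, add_zero])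

/-- A character agreeing with `φ` on `S` agrees with `φ` on the principal component. -/
lemma apply_eq_of_mem_connectedComponentIn (hsm : SpectrallyMultiplicative φ) (h1 : φ 1 = 1)
    (hcont : Continuous φ) {S : Set A}
    (hS : ∀ a ∈ S, ∀ z ∈ spectrum ℂ a, z.im = 0)
    (hspan : ∀ x : A, ∃ a ∈ S, ∃ b ∈ S, x = a + Complex.I • b) (χ : A →ₐ[ℂ] ℂ)
    (hχ : ∀ a ∈ S, χ a = φ a) {x : A} (hx : x ∈ connectedComponentIn {x : A | IsUnit x} 1) :
    χ x = φ x := by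
  have hx' := connectedComponentIn_isUnit_subset (Submonoid.isClosed_topologicalClosure _)
    (exp_mem_topologicalClosure hspan) hx
  have hcl : IsClosed {x : A | χ x = φ x} := isClosed_eq (map_continuous χ) hcont
  refine hcl.closure_subset_iff.2 (fun g hg => ?_) hx'
  change χ g = φ g
  induction hg using Submonoid.closure_induction with
  | mem y hy =>
    obtain ⟨a, ha, t, rfl⟩ := hy
    rw [map_exp_algHom, hsm.apply_exp_smul h1 hcont (hS a ha), map_smul, hχ a ha, smul_eq_mul]
  | one => rw [map_one, h1]
  | mul y z hy hz ihy ihz =>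
    rw [map_mul, ihy, ihz, hsm.apply_mul_of_mem_expSubmonoid h1 hcont hS hy hz]

end SpectrallyMultiplicative

section RealImaginaryParts

variable {A : Type*} [Ring A] [Algebra ℂ A] [StarRing A]

lemma reP_add (x y : A) : reP (x + y) = reP x + reP y := by
  simp only [reP, star_add, ← smul_add]
  abel_nf

lemma imP_add (x y : A) : imP (x + y) = imP x + imP y := by
  simp only [imP, star_add, ← smul_add]
  abel_nf

lemma reP_of_star_eq {a : A} (ha : star a = a) : reP a = a := by
  rw [reP, ha, ← two_smul ℂ, smul_smul, inv_mul_cancel₀ two_ne_zero, one_smul]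

lemma imP_of_star_eq {a : A} (ha : star a = a) : imP a = 0 := by
  rw [imP, ha, sub_self, smul_zero]

lemma reP_add_I_smul_imP (x : A) : reP x + Complex.I • imP x = x := by
  have h : Complex.I * (2 * Complex.I)⁻¹ = 2⁻¹ := by field_simp
  rw [reP, imP, smul_smul, h, ← smul_add, add_add_sub_cancel, ← two_smul ℂ, smul_smul,
    inv_mul_cancel₀ two_ne_zero, one_smul]

variable [StarModule ℂ A]

lemma star_reP (x : A) : star (reP x) = reP x := by
  simp [reP, add_comm]

lemma star_imP (x : A) : star (imP x) = imP x := by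
  rw [imP, star_smul, star_sub, star_star, ← neg_sub x, smul_neg, ← neg_smul]
  simp

lemma reP_smul (z : ℂ) (x : A) :
    reP (z • x) = (z.re : ℂ) • reP x + ((-z.im : ℝ) : ℂ) • imP x := by
  have hz : conj z = z.re - z.im * Complex.I := by
    apply Complex.ext <;> simp
  rw [reP, reP, imP, star_smul, Complex.star_def, hz]
  nth_rewrite 1 [← Complex.re_add_im z]
  simp only [smul_add, smul_sub, add_smul, sub_smul, smul_smul, mul_inv, Complex.inv_I,
    Complex.ofReal_neg]
  module

lemma imP_smul (z : ℂ) (x : A) :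
    imP (z • x) = (z.re : ℂ) • imP x + (z.im : ℂ) • reP x := by
  have hz : conj z = z.re - z.im * Complex.I := by
    apply Complex.ext <;> simp
  have hI : ∀ w : ℂ, w * (2⁻¹ * -Complex.I) * Complex.I = w * 2⁻¹ := fun w => by
    linear_combination (-w * 2⁻¹) * Complex.I_mul_I
  rw [reP, imP, imP, star_smul, Complex.star_def, hz]
  nth_rewrite 1 [← Complex.re_add_im z]
  have h2 : ((2 : ℂ) * Complex.I)⁻¹ * (z.im * Complex.I) = z.im * 2⁻¹ := by field_simp
  simp only [smul_add, smul_sub, add_smul, sub_smul, smul_smul, h2]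
  module

end RealImaginaryParts

theorem stmt_19 {A : Type*} [NormedRing A] [NormedAlgebra ℂ A] [CompleteSpace A]
    [StarRing A] [StarModule ℂ A]
    (hHerm : ∀ a : A, star a = a → ∀ z ∈ spectrum ℂ a, z.im = 0)
    (φ : A → ℂ) (hcont : Continuous φ) (hsm : SpectrallyMultiplicative φ)
    (h1 : φ 1 = 1) :
    IsCharacter (fun x : A => φ (reP x) + Complex.I * φ (imP x)) ∧
      ∀ x ∈ connectedComponentIn {x : A | IsUnit x} 1 ∪ {a : A | star a = a},
        φ (reP x) + Complex.I * φ (imP x) = φ x := by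
  let S : Set A := {a : A | star a = a}
  have hS : ∀ a ∈ S, ∀ z ∈ spectrum ℂ a, z.im = 0 := hHerm
  have hspan : ∀ x : A, ∃ a ∈ S, ∃ b ∈ S, x = a + Complex.I • b := fun x =>
    ⟨reP x, star_reP x, imP x, star_imP x, (reP_add_I_smul_imP x).symm⟩
  have hadd : ∀ a ∈ S, ∀ b ∈ S, φ (a + b) = φ a + φ b := fun a ha b hb =>
    hsm.apply_add h1 hcont hS hspan ha hb (IsSelfAdjoint.add ha hb)
  have hsmulS : ∀ r : ℝ, ∀ a ∈ S, (r : ℂ) • a ∈ S := fun r a ha => by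
    change star ((r : ℂ) • a) = (r : ℂ) • a
    rw [star_smul, Complex.star_def, Complex.conj_ofReal, ha]
  have hsmul : ∀ r : ℝ, ∀ a ∈ S, φ ((r : ℂ) • a) = r * φ a := fun r a ha => by
    have h := hsm.apply_aeval h1 hcont (hS a ha) (Polynomial.C (r : ℂ) * Polynomial.X)
      (fun s hs => by simp [hS a ha s hs])
    rwa [map_mul, Polynomial.aeval_C, Polynomial.aeval_X, ← Algebra.smul_def, Polynomial.eval_mul,
      Polynomial.eval_C, Polynomial.eval_X] at h
  have hsq : ∀ a ∈ S, φ (a * a) = φ a * φ a := fun a ha => by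
    have h := hsm.apply_aeval h1 hcont (hS a ha) (Polynomial.X * Polynomial.X)
      (fun s hs => by simp [hS a ha s hs])
    rwa [map_mul, Polynomial.aeval_X, Polynomial.eval_mul, Polynomial.eval_X] at h
  have hψS : ∀ a ∈ S, φ (reP a) + Complex.I * φ (imP a) = φ a := fun a ha => by
    have h0 : φ 0 = 0 := by simpa using hsmul 0 a ha
    rw [reP_of_star_eq ha, imP_of_star_eq ha, h0, mul_zero, add_zero]
  let ψ : A →ₗ[ℂ] ℂ :=
    { toFun := fun x => φ (reP x) + Complex.I * φ (imP x)
      map_add' := fun x y => by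
        rw [reP_add, imP_add, hadd _ (star_reP x) _ (star_reP y),
          hadd _ (star_imP x) _ (star_imP y)]
        ring
      map_smul' := fun z x => by
        rw [reP_smul, imP_smul, hadd _ (hsmulS _ _ (star_reP x)) _ (hsmulS _ _ (star_imP x)),
          hadd _ (hsmulS _ _ (star_imP x)) _ (hsmulS _ _ (star_reP x)),
          hsmul _ _ (star_reP x), hsmul _ _ (star_reP x), hsmul _ _ (star_imP x),
          hsmul _ _ (star_imP x), RingHom.id_apply, smul_eq_mul]
        nth_rewrite 5 [← Complex.re_add_im z]
        push_cast
        linear_combination (-z.im * φ (imP x)) * Complex.I_mul_I }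
  have hψ : ∀ a ∈ S, ψ a = φ a := hψS
  have hψ1 : ψ 1 = 1 := (hψ 1 (star_one A)).trans h1
  have hψsqS : ∀ a ∈ S, ψ (a * a) = ψ a * ψ a := fun a ha => by
    have haa : star (a * a) = a * a := by rw [star_mul, ha]
    rw [hψ _ haa, hψ a ha, hsq a ha]
  have hψsq : ∀ x, ψ (x * x) = ψ x * ψ x := fun x => by
    obtain ⟨a, ha, b, hb, rfl⟩ := hspan x
    have hab := hψsqS (a + b) (IsSelfAdjoint.add ha hb)
    simp only [add_mul, mul_add, map_add, hψsqS a ha, hψsqS b hb] at hab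
    simp only [add_mul, mul_add, map_add, smul_mul_assoc, mul_smul_comm, map_smul, smul_eq_mul,
      hψsqS a ha, hψsqS b hb]
    linear_combination Complex.I * hab
  have hψmul := ψ.map_mul_of_map_mul_self hψ1 hψsq
  refine ⟨⟨fun h => ?_, ψ.isLinear, hψmul⟩, ?_⟩
  · exact one_ne_zero (hψ1.symm.trans (congrFun h 1))
  · rintro x (hx | hx)
    · exact hsm.apply_eq_of_mem_connectedComponentIn h1 hcont hS hspan
        (AlgHom.ofLinearMap ψ hψ1 hψmul) hψ hx
    · exact hψS x hx
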